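/- arXiv:1701.02129 — 5 statements merged into one kernel-verified Lean document; each statement's English description precedes it below -/
import Mathlib

section
/- Let N be a standard Gaussian random variable and define φ_4(α) := 8 ∫_0^∞ x³ P(N ≥ |α| + x) dx. Then for every α > 0, φ_4(α) ≤ (16√2/√π) · e^{−α²/4} / α. -/
open MeasureTheory ProbabilityTheory Real Set

/-- `P(N ≥ a)` for a standard Gaussian random variable `N`. -/
noncomputable def gaussTail (a : ℝ) : ℝ := ((gaussianReal 0 1) (Set.Ici a)).toReal

/-- `φ_4(α) := 8 ∫_0^∞ x³ P(N ≥ |α| + x) dx`. -/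
noncomputable def phiFour (α : ℝ) : ℝ :=
  8 * ∫ x in Set.Ioi (0 : ℝ), x ^ 3 * gaussTail (|α| + x)

/-- The Chernoff bound for the standard Gaussian distribution. -/
lemma gaussTail_le_exp {a : ℝ} (ha : 0 ≤ a) : gaussTail a ≤ exp (-a ^ 2 / 2) := by
  have h := measure_ge_le_exp_mul_mgf (μ := gaussianReal 0 1) (X := id) a ha
    (integrable_exp_mul_gaussianReal a)
  rw [mgf_id_gaussianReal, ← exp_add] at h
  calc gaussTail a ≤ exp (-a * a + (0 * a + ((1 : NNReal) : ℝ) * a ^ 2 / 2)) := h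
    _ = exp (-a ^ 2 / 2) := by congr 1; push_cast; ring

lemma integrableOn_sq_mul_exp_neg_half_mul_sq :
    IntegrableOn (fun x : ℝ => x ^ 2 * exp (-(1 / 2) * x ^ 2)) (Ioi 0) := by
  simpa only [rpow_two] using
    integrableOn_rpow_mul_exp_neg_mul_sq (b := 1 / 2) (s := 2) (by norm_num) (by norm_num)

lemma integral_sq_mul_exp_neg_half_mul_sq :
    ∫ x in Ioi (0 : ℝ), x ^ 2 * exp (-(1 / 2) * x ^ 2) = √2 * √π / 2 := by
  have h := integral_rpow_mul_exp_neg_mul_rpow (p := 2) (q := 2) (b := 1 / 2)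
    (by norm_num) (by norm_num) (by norm_num)
  simp only [rpow_two] at h
  rw [h]
  have hΓ : Gamma ((2 + 1) / 2) = √π / 2 := by
    rw [show ((2 : ℝ) + 1) / 2 = 1 / 2 + 1 by norm_num, Gamma_add_one (by norm_num),
      Gamma_one_half_eq]
    ring
  have h2 : (1 / 2 : ℝ) ^ (-((2 : ℝ) + 1) / 2) = 2 * √2 := by
    rw [one_div, inv_rpow (by norm_num), ← rpow_neg (by norm_num),
      show -(-((2 : ℝ) + 1) / 2) = 1 + 1 / 2 by norm_num, rpow_add (by norm_num), rpow_one,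
      ← sqrt_eq_rpow]
  rw [hΓ, h2]
  ring

lemma cube_mul_gaussTail_le {α x : ℝ} (hα : 0 < α) (hx : 0 < x) :
    x ^ 3 * gaussTail (α + x) ≤
      exp (-α ^ 2 / 4) / α * (x ^ 2 * exp (-(1 / 2) * x ^ 2)) := by
  have hlin : α * x * exp (-(α * x)) ≤ 1 := by
    rw [exp_neg, ← div_eq_mul_inv, div_le_one (exp_pos _)]
    linarith [add_one_le_exp (α * x)]
  have hα4 : exp (-α ^ 2 / 2) ≤ exp (-α ^ 2 / 4) := exp_le_exp.2 (by nlinarith [sq_nonneg α])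
  calc x ^ 3 * gaussTail (α + x)
      ≤ x ^ 3 * exp (-(α + x) ^ 2 / 2) := by
        gcongr
        exact gaussTail_le_exp (by positivity)
    _ = exp (-α ^ 2 / 2) / α * (α * x * exp (-(α * x))) * (x ^ 2 * exp (-(1 / 2) * x ^ 2)) := by
        rw [show -(α + x) ^ 2 / 2 = -α ^ 2 / 2 + -(α * x) + -(1 / 2) * x ^ 2 by ring,
          exp_add, exp_add]
        field_simp
    _ ≤ exp (-α ^ 2 / 4) / α * 1 * (x ^ 2 * exp (-(1 / 2) * x ^ 2)) := by gcongr
    _ = _ := by ring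

/-- for every `α > 0`, `φ_4(α) ≤ (16√2/√π) e^{−α²/4} / α`. -/
theorem phiFour_le (α : ℝ) (hα : 0 < α) :
    phiFour α ≤ (16 * Real.sqrt 2 / Real.sqrt Real.pi) * Real.exp (-α ^ 2 / 4) / α := by
  have hint : ∫ x in Ioi (0 : ℝ), x ^ 3 * gaussTail (|α| + x) ≤
      exp (-α ^ 2 / 4) / α * (√2 * √π / 2) := by
    rw [abs_of_pos hα, ← integral_sq_mul_exp_neg_half_mul_sq, ← integral_const_mul]
    refine integral_mono_of_nonneg ?_ (integrableOn_sq_mul_exp_neg_half_mul_sq.const_mul _) ?_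
    · filter_upwards [ae_restrict_mem measurableSet_Ioi] with x hx
      exact mul_nonneg (pow_nonneg (le_of_lt hx) 3) ENNReal.toReal_nonneg
    · filter_upwards [ae_restrict_mem measurableSet_Ioi] with x hx
      exact cube_mul_gaussTail_le hα hx
  have hconst : 4 * (√2 * √π) ≤ 16 * √2 / √π := by
    rw [le_div_iff₀ (by positivity), mul_assoc, mul_assoc, mul_self_sqrt pi_pos.le]
    nlinarith [pi_le_four, sqrt_nonneg 2]
  calc phiFour α ≤ 8 * (exp (-α ^ 2 / 4) / α * (√2 * √π / 2)) := by
        unfold phiFour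
        gcongr
    _ = 4 * (√2 * √π) * exp (-α ^ 2 / 4) / α := by ring
    _ ≤ _ := by gcongr
end

section
/- Define ψ(x) := ∫_{−∞}^∞ (x−y)² sgn(y) e^{−(|x|+|y|)²/2}/√(2π) dy for x ∈ ℝ, where sgn(y) = 1 for y > 0, −1 for y < 0 and 0 for y = 0. Then for every x > 0, ψ(x) = 4x ( x (1 − Φ(x)) − φ(x) ), where Φ is the standard normal cumulative distribution function and φ(z) = e^{−z²/2}/√(2π) is the standard normal density. -/
open MeasureTheory ProbabilityTheory Real Set

/-- `ψ(x) := ∫_{−∞}^∞ (x−y)² sgn(y) e^{−(|x|+|y|)²/2}/√(2π) dy`, with `sgn(0)=0`. -/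
noncomputable def psiFun (x : ℝ) : ℝ :=
  ∫ y : ℝ, (x - y) ^ 2 * Real.sign y * (Real.exp (-(|x| + |y|) ^ 2 / 2) / Real.sqrt (2 * Real.pi))

/-- The standard normal cumulative distribution function. -/
noncomputable def stdGaussCDF (x : ℝ) : ℝ := ((gaussianReal 0 1) (Set.Iic x)).toReal

/-- The standard normal density in the form used in `psiFun_eq`. -/
noncomputable def stdGaussDensity (u : ℝ) : ℝ := Real.exp (-u ^ 2 / 2) / Real.sqrt (2 * Real.pi)

theorem stdGaussDensity_eq_gaussianPDFReal (u : ℝ) :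
    stdGaussDensity u = gaussianPDFReal 0 1 u := by
  simp [stdGaussDensity, gaussianPDFReal, div_eq_inv_mul]

theorem integrable_stdGaussDensity : Integrable stdGaussDensity := by
  have h := integrable_gaussianPDFReal 0 1
  rwa [← funext stdGaussDensity_eq_gaussianPDFReal] at h

theorem integrable_mul_stdGaussDensity : Integrable fun u : ℝ => u * stdGaussDensity u := by
  refine ((integrable_mul_exp_neg_mul_sq (b := 1 / 2) (by norm_num)).div_const
    (Real.sqrt (2 * Real.pi))).congr (Filter.Eventually.of_forall fun u => ?_)
  simp only [stdGaussDensity]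
  rw [show -u ^ 2 / 2 = -(1 / 2) * u ^ 2 by ring]
  ring

theorem integrable_sq_mul_stdGaussDensity : Integrable fun u : ℝ => u ^ 2 * stdGaussDensity u := by
  refine ((integrable_rpow_mul_exp_neg_mul_sq (b := 1 / 2) (by norm_num) (s := 2)
    (by norm_num)).div_const (Real.sqrt (2 * Real.pi))).congr
    (Filter.Eventually.of_forall fun u => ?_)
  simp only [stdGaussDensity]
  rw [show -u ^ 2 / 2 = -(1 / 2) * u ^ 2 by ring, Real.rpow_two]
  ring

theorem integral_Ioi_mul_stdGaussDensity (x : ℝ) :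
    ∫ u in Ioi x, u * stdGaussDensity u = stdGaussDensity x := by
  have hderiv (u : ℝ) : HasDerivAt (fun v => -stdGaussDensity v) (u * stdGaussDensity u) u := by
    have h := ((((hasDerivAt_id u).pow 2).neg.div_const 2).exp.div_const
      (Real.sqrt (2 * Real.pi))).neg
    refine h.congr_deriv ?_
    simp [stdGaussDensity]
    ring
  have hint := integrable_mul_stdGaussDensity.integrableOn (s := Ioi x)
  have hlim := tendsto_zero_of_hasDerivAt_of_integrableOn_Ioi (fun u _ => hderiv u) hint
    integrable_stdGaussDensity.neg.integrableOn
  rw [integral_Ioi_of_hasDerivAt_of_tendsto' (fun u _ => hderiv u) hint hlim]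
  ring

theorem integral_Ioi_stdGaussDensity (x : ℝ) :
    ∫ u in Ioi x, stdGaussDensity u = 1 - stdGaussCDF x := by
  have hcdf : stdGaussCDF x = ∫ u in Iic x, stdGaussDensity u := by
    simp_rw [stdGaussDensity_eq_gaussianPDFReal]
    rw [stdGaussCDF, gaussianReal_apply_eq_integral 0 one_ne_zero (Iic x),
      ENNReal.toReal_ofReal (integral_nonneg fun u => gaussianPDFReal_nonneg 0 1 u)]
  have htotal : ∫ u, stdGaussDensity u = 1 := by
    simp_rw [stdGaussDensity_eq_gaussianPDFReal]
    exact integral_gaussianPDFReal_eq_one 0 one_ne_zero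
  rw [hcdf, ← htotal, ← intervalIntegral.integral_Iic_add_Ioi
    (integrable_stdGaussDensity.integrableOn (s := Iic x)) integrable_stdGaussDensity.integrableOn]
  ring

theorem integral_Ioi_zero_mul_stdGaussDensity_add (x : ℝ) :
    ∫ y in Ioi 0, y * stdGaussDensity (x + y) = stdGaussDensity x - x * (1 - stdGaussCDF x) := by
  have hshift := (measurePreserving_add_left volume x).setIntegral_preimage_emb
    (measurableEmbedding_addLeft x) (fun u => (u - x) * stdGaussDensity u) (Ioi x)
  rw [preimage_const_add_Ioi, sub_self] at hshift
  simp only [add_sub_cancel_left] at hshift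
  rw [hshift]
  simp only [sub_mul]
  rw [integral_sub integrable_mul_stdGaussDensity.integrableOn
    (integrable_stdGaussDensity.const_mul x).integrableOn, integral_const_mul,
    integral_Ioi_mul_stdGaussDensity, integral_Ioi_stdGaussDensity]

theorem psiFun_eq_integral_Ioi (x : ℝ) (hx : 0 < x) :
    psiFun x = ∫ y in Ioi 0, -(4 * x) * (y * stdGaussDensity (x + y)) := by
  set f : ℝ → ℝ := fun y => (x - y) ^ 2 * Real.sign y *
    (Real.exp (-(|x| + |y|) ^ 2 / 2) / Real.sqrt (2 * Real.pi)) with hf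
  have hpos : EqOn f (fun y => (x - y) ^ 2 * stdGaussDensity (x + y)) (Ioi 0) := by
    intro y hy
    simp [hf, stdGaussDensity, Real.sign_of_pos hy, abs_of_pos hx, abs_of_pos (mem_Ioi.mp hy)]
  have hneg : EqOn (fun y => f (-y)) (fun y => -((x + y) ^ 2 * stdGaussDensity (x + y)))
      (Ioi 0) := by
    intro y hy
    simp [hf, stdGaussDensity, Real.sign_of_neg (neg_neg_of_pos (mem_Ioi.mp hy)), abs_of_pos hx,
      abs_of_pos (mem_Ioi.mp hy)]
  have hP : Integrable fun y => (x - y) ^ 2 * stdGaussDensity (x + y) := by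
    have h := ((integrable_sq_mul_stdGaussDensity.sub
      (integrable_mul_stdGaussDensity.const_mul (4 * x))).add
      (integrable_stdGaussDensity.const_mul (4 * x ^ 2))).comp_add_left x
    refine h.congr (Filter.Eventually.of_forall fun y => ?_)
    simp only [Pi.add_apply, Pi.sub_apply]
    ring
  have hQ : Integrable fun y => (x + y) ^ 2 * stdGaussDensity (x + y) :=
    integrable_sq_mul_stdGaussDensity.comp_add_left x
  have hf_pos : IntegrableOn f (Ioi 0) :=
    hP.integrableOn.congr_fun hpos.symm measurableSet_Ioi
  have hf_neg : IntegrableOn f (Iic 0) := by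
    have h : IntegrableOn (fun y => f (-y)) (Ioi 0) :=
      hQ.neg.integrableOn.congr_fun hneg.symm measurableSet_Ioi
    rw [integrableOn_Iic_iff_integrableOn_Iio]
    simpa using h.comp_neg
  calc psiFun x = (∫ y in Iic 0, f y) + ∫ y in Ioi 0, f y :=
        (intervalIntegral.integral_Iic_add_Ioi hf_neg hf_pos).symm
    _ = (∫ y in Ioi 0, f (-y)) + ∫ y in Ioi 0, f y := by
        rw [integral_comp_neg_Ioi, neg_zero]
    _ = (∫ y in Ioi 0, -((x + y) ^ 2 * stdGaussDensity (x + y))) +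
          ∫ y in Ioi 0, (x - y) ^ 2 * stdGaussDensity (x + y) := by
        rw [setIntegral_congr_fun measurableSet_Ioi hneg,
          setIntegral_congr_fun measurableSet_Ioi hpos]
    _ = ∫ y in Ioi 0, -(4 * x) * (y * stdGaussDensity (x + y)) := by
        rw [integral_neg, neg_add_eq_sub, ← integral_sub hP.integrableOn hQ.integrableOn]
        congr 1 with y
        ring

/-- for every `x > 0`,
`ψ(x) = 4x ( x (1 − Φ(x)) − φ(x) )` where `Φ` is the standard normal CDF and
`φ(z) = e^{−z²/2}/√(2π)` the standard normal density. -/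
theorem psiFun_eq (x : ℝ) (hx : 0 < x) :
    psiFun x
      = 4 * x * (x * (1 - stdGaussCDF x) - Real.exp (-x ^ 2 / 2) / Real.sqrt (2 * Real.pi)) := by
  rw [psiFun_eq_integral_Ioi x hx, integral_const_mul, integral_Ioi_zero_mul_stdGaussDensity_add,
    stdGaussDensity]
  ring
end

section
/- For θ ∈ [−1,1], t > 0 and x, y ∈ ℝ, let p(t,u) := (2πt)^{−1/2} e^{−u²/(2t)} and define the skew Brownian motion transition density p_θ(t,x,y) := p(t, x−y) + sgn(y) θ p(t, |x|+|y|), with sgn(0)=0. Then for every x ∈ ℝ, t > 0 and θ ∈ [−1,1], ∫_ℝ (y−x)² p_θ(t,x,y) dy = t + θ t ψ(x/√t), where ψ(x) := ∫_{−∞}^∞ (x−y)² sgn(y) e^{−(|x|+|y|)²/2}/√(2π) dy. -/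
open MeasureTheory Real Set

/-- The Gaussian heat kernel `p(t,u) := (2πt)^{−1/2} e^{−u²/(2t)}`. -/
noncomputable def heatKernel (t u : ℝ) : ℝ :=
  (2 * Real.pi * t) ^ (-(1 : ℝ) / 2) * Real.exp (-u ^ 2 / (2 * t))

/-- The skew Brownian motion transition density
`p_θ(t,x,y) := p(t, x−y) + sgn(y) θ p(t, |x|+|y|)`, with `sgn(0)=0`. -/
noncomputable def sbmDensity (θ t x y : ℝ) : ℝ :=
  heatKernel t (x - y) + Real.sign y * θ * heatKernel t (|x| + |y|)

lemma heatKernel_eq {t : ℝ} (ht : 0 < t) (u : ℝ) :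
    heatKernel t u = (√(2 * π * t))⁻¹ * Real.exp (-u ^ 2 / (2 * t)) := by
  rw [heatKernel, Real.sqrt_eq_rpow, ← Real.rpow_neg (by positivity)]
  norm_num

lemma measurable_real_sign : Measurable Real.sign := by
  unfold Real.sign
  exact Measurable.ite measurableSet_Iio measurable_const
    (Measurable.ite measurableSet_Ioi measurable_const measurable_const)

lemma integral_sq_mul_heatKernel {t : ℝ} (ht : 0 < t) (x : ℝ) :
    ∫ y : ℝ, (y - x) ^ 2 * heatKernel t (x - y) = t := by
  have hv := ProbabilityTheory.variance_fun_id_gaussianReal (μ := x) (v := t.toNNReal)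
  rw [ProbabilityTheory.variance_eq_integral (by fun_prop),
    ProbabilityTheory.integral_id_gaussianReal,
    ProbabilityTheory.integral_gaussianReal_eq_integral_smul
      (Real.toNNReal_pos.2 ht).ne', Real.coe_toNNReal t ht.le] at hv
  refine Eq.trans (integral_congr_ae (Filter.Eventually.of_forall fun y => ?_)) hv
  simp only [heatKernel_eq ht, ProbabilityTheory.gaussianPDFReal, smul_eq_mul, Real.coe_toNNReal t ht.le]
  rw [← neg_sub y x, neg_sq]
  ring

lemma integrable_sq_mul_heatKernel {t : ℝ} (ht : 0 < t) (x : ℝ) :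
    Integrable fun y : ℝ => (y - x) ^ 2 * heatKernel t (x - y) := by
  refine .of_integral_ne_zero ?_
  rw [integral_sq_mul_heatKernel ht]
  exact ht.ne'

lemma integrable_sq_mul_sign_mul_heatKernel {t : ℝ} (ht : 0 < t) (x : ℝ) :
    Integrable fun y : ℝ => (y - x) ^ 2 * Real.sign y * heatKernel t (|x| + |y|) := by
  refine (integrable_sq_mul_heatKernel ht x).mono' ?_ (Filter.Eventually.of_forall fun y => ?_)
  · have := measurable_real_sign
    unfold heatKernel
    fun_prop
  · have hs : |Real.sign y| ≤ 1 := by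
      rcases Real.sign_apply_eq y with h | h | h <;> simp [h]
    have hk : heatKernel t (|x| + |y|) ≤ heatKernel t (x - y) := by
      have hsq : (x - y) ^ 2 ≤ (|x| + |y|) ^ 2 := sq_le_sq' (by
        linarith [neg_abs_le (x - y), abs_sub x y]) (by linarith [le_abs_self (x - y), abs_sub x y])
      rw [heatKernel_eq ht, heatKernel_eq ht]
      gcongr
    have h0 : 0 ≤ heatKernel t (|x| + |y|) := by
      rw [heatKernel_eq ht]
      positivity
    rw [norm_mul, norm_mul, Real.norm_eq_abs, Real.norm_eq_abs, Real.norm_eq_abs,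
      abs_of_nonneg (sq_nonneg _), abs_of_nonneg h0]
    calc (y - x) ^ 2 * |Real.sign y| * heatKernel t (|x| + |y|)
        ≤ (y - x) ^ 2 * 1 * heatKernel t (x - y) := by gcongr
      _ = _ := by ring

lemma sign_mul_of_pos {s : ℝ} (hs : 0 < s) (z : ℝ) : Real.sign (s * z) = Real.sign z := by
  rcases lt_trichotomy z 0 with h | rfl | h
  · rw [Real.sign_of_neg h, Real.sign_of_neg (mul_neg_of_pos_of_neg hs h)]
  · simp
  · rw [Real.sign_of_pos h, Real.sign_of_pos (mul_pos hs h)]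

lemma integral_sq_mul_sign_mul_heatKernel {t : ℝ} (ht : 0 < t) (x : ℝ) :
    ∫ y : ℝ, (y - x) ^ 2 * Real.sign y * heatKernel t (|x| + |y|) = t * psiFun (x / √t) := by
  have hs : 0 < √t := Real.sqrt_pos.2 ht
  have hst : √t ^ 2 = t := Real.sq_sqrt ht.le
  have key := Measure.integral_comp_mul_left
    (fun y : ℝ => (y - x) ^ 2 * Real.sign y * heatKernel t (|x| + |y|)) √t
  rw [abs_of_pos (inv_pos.2 hs), smul_eq_mul, eq_inv_mul_iff_mul_eq₀ hs.ne'] at key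
  rw [← key, psiFun, ← integral_const_mul, ← integral_const_mul]
  congr 1
  ext z
  rw [sign_mul_of_pos hs, heatKernel_eq ht, abs_mul, abs_div, abs_of_pos hs,
    Real.sqrt_mul (by positivity)]
  have hexp : -(|x| + √t * |z|) ^ 2 / (2 * t) = -(|x| / √t + |z|) ^ 2 / 2 := by
    have h : |x| + √t * |z| = √t * (|x| / √t + |z|) := by field_simp
    rw [h, mul_pow, hst]
    field_simp
  have hsq : (√t * z - x) ^ 2 = t * (x / √t - z) ^ 2 := by
    have h : √t * z - x = -(√t * (x / √t - z)) := by field_simp; ring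
    rw [h, neg_sq, mul_pow, hst]
  rw [hexp, hsq]
  field_simp

/-- for every `x ∈ ℝ`, `t > 0` and `θ ∈ [−1,1]`,
`∫_ℝ (y−x)² p_θ(t,x,y) dy = t + θ t ψ(x/√t)`. -/
theorem sbm_second_moment (θ : ℝ) (hθ : θ ∈ Set.Icc (-1 : ℝ) 1) (t : ℝ) (ht : 0 < t) (x : ℝ) :
    ∫ y : ℝ, (y - x) ^ 2 * sbmDensity θ t x y
      = t + θ * t * psiFun (x / Real.sqrt t) := by
  calc ∫ y : ℝ, (y - x) ^ 2 * sbmDensity θ t x y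
      = ∫ y : ℝ, ((y - x) ^ 2 * heatKernel t (x - y)
          + θ * ((y - x) ^ 2 * Real.sign y * heatKernel t (|x| + |y|))) := by
        congr 1
        ext y
        rw [sbmDensity]
        ring
    _ = t + θ * t * psiFun (x / √t) := by
        rw [integral_add (integrable_sq_mul_heatKernel ht x)
          ((integrable_sq_mul_sign_mul_heatKernel ht x).const_mul θ), integral_const_mul,
          integral_sq_mul_heatKernel ht, integral_sq_mul_sign_mul_heatKernel ht, mul_assoc]
end

section
/- Let σ_+, σ_− > 0 and define f : ℝ \ {0} → ℝ by f(x) = (2σ_+/(σ_− + σ_+)) ∫_0^1 Φ(−x/(σ_+ √t)) dt for x > 0 and f(x) = −(2σ_−/(σ_− + σ_+)) ∫_0^1 Φ(x/(σ_− √t)) dt for x < 0, where Φ is the standard normal cumulative distribution function. Then f is Lebesgue integrable on ℝ and (1/σ_+²) ∫_0^∞ f(x) dx + (1/σ_−²) ∫_{−∞}^0 f(x) dx = 0. -/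
open MeasureTheory ProbabilityTheory Real Set

/-- The function `f` of STATEMENT 10:
`f(x) = (2σ₊/(σ₋+σ₊)) ∫_0^1 Φ(−x/(σ₊√t)) dt` for `x > 0` and
`f(x) = −(2σ₋/(σ₋+σ₊)) ∫_0^1 Φ(x/(σ₋√t)) dt` for `x < 0` (and `0` at `x = 0`). -/
noncomputable def signChangeFun (σp σm : ℝ) (x : ℝ) : ℝ :=
  if 0 < x then
    (2 * σp / (σm + σp)) * ∫ t in Set.Ioc (0 : ℝ) 1, stdGaussCDF (-x / (σp * Real.sqrt t))
  else if x < 0 then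
    -((2 * σm / (σm + σp)) * ∫ t in Set.Ioc (0 : ℝ) 1, stdGaussCDF (x / (σm * Real.sqrt t)))
  else 0

lemma monotone_stdGaussCDF : Monotone stdGaussCDF := fun _ _ h =>
  measureReal_mono (Iic_subset_Iic.2 h)

lemma stdGaussCDF_nonneg (x : ℝ) : 0 ≤ stdGaussCDF x := ENNReal.toReal_nonneg

lemma stdGaussCDF_le_one (x : ℝ) : stdGaussCDF x ≤ 1 := measureReal_le_one

/-- The Chernoff bound for the standard normal lower tail, with exponent `1`. -/
lemma stdGaussCDF_neg_le (x : ℝ) : stdGaussCDF (-x) ≤ exp (1 / 2) * exp (-x) := by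
  have h := measure_le_le_exp_mul_mgf (μ := gaussianReal 0 1) (X := id) (t := -1) (-x)
    (by norm_num) (integrable_exp_mul_gaussianReal (-1))
  rw [mgf_id_gaussianReal] at h
  refine h.trans_eq ?_
  norm_num [mul_comm]

lemma integrableOn_stdGaussCDF_div_sqrt (y : ℝ) :
    IntegrableOn (fun t : ℝ => stdGaussCDF (-y / √t)) (Ioc 0 1) := by
  refine Measure.integrableOn_of_bounded (M := 1) (by simp) ?_ (ae_of_all _ fun t => ?_)
  · exact (monotone_stdGaussCDF.measurable.comp (by fun_prop)).aestronglyMeasurable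
  · rw [norm_of_nonneg (stdGaussCDF_nonneg _)]
    exact stdGaussCDF_le_one _

/-- The average over `t ∈ (0, 1]` of the normal lower tail probabilities at `-y / √t`. -/
noncomputable def avgGaussTail (y : ℝ) : ℝ := ∫ t in Ioc (0 : ℝ) 1, stdGaussCDF (-y / √t)

lemma avgGaussTail_nonneg (y : ℝ) : 0 ≤ avgGaussTail y :=
  integral_nonneg fun _ => stdGaussCDF_nonneg _

lemma antitone_avgGaussTail : Antitone avgGaussTail := fun x y h =>
  integral_mono (integrableOn_stdGaussCDF_div_sqrt y) (integrableOn_stdGaussCDF_div_sqrt x)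
    fun _ => monotone_stdGaussCDF (by gcongr)

lemma avgGaussTail_le {y : ℝ} (hy : 0 ≤ y) : avgGaussTail y ≤ stdGaussCDF (-y) := by
  have h : avgGaussTail y ≤ ∫ _ in Ioc (0 : ℝ) 1, stdGaussCDF (-y) := by
    refine setIntegral_mono_on (integrableOn_stdGaussCDF_div_sqrt y)
      (integrableOn_const (by simp)) measurableSet_Ioc fun t ht => monotone_stdGaussCDF ?_
    rw [neg_div, neg_le_neg_iff]
    exact le_div_self hy (sqrt_pos.2 ht.1) (sqrt_le_one.2 ht.2)
  simpa using h

lemma integrableOn_avgGaussTail : IntegrableOn avgGaussTail (Ioi 0) := by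
  refine Integrable.mono' ((integrableOn_exp_neg_Ioi 0).const_mul (exp (1 / 2)))
    antitone_avgGaussTail.measurable.aestronglyMeasurable ?_
  filter_upwards [ae_restrict_mem measurableSet_Ioi] with y hy
  rw [norm_of_nonneg (avgGaussTail_nonneg y)]
  exact (avgGaussTail_le (le_of_lt hy)).trans (stdGaussCDF_neg_le y)

lemma signChangeFun_of_pos (σp σm : ℝ) {x : ℝ} (hx : 0 < x) :
    signChangeFun σp σm x = 2 * σp / (σm + σp) * avgGaussTail (σp⁻¹ * x) := by
  simp only [signChangeFun, if_pos hx, avgGaussTail]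
  congr! 4
  ring

lemma signChangeFun_neg_of_pos (σp σm : ℝ) {x : ℝ} (hx : 0 < x) :
    signChangeFun σp σm (-x) = -(2 * σm / (σm + σp) * avgGaussTail (σm⁻¹ * x)) := by
  simp only [signChangeFun, if_neg (neg_neg_of_pos hx).not_gt, if_pos (neg_neg_of_pos hx),
    avgGaussTail]
  congr! 5
  ring

lemma integrableOn_avgGaussTail_inv_mul {σ : ℝ} (hσ : 0 < σ) :
    IntegrableOn (fun x => avgGaussTail (σ⁻¹ * x)) (Ioi 0) := by
  rw [integrableOn_Ioi_comp_mul_left_iff _ _ (inv_pos.2 hσ), mul_zero]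
  exact integrableOn_avgGaussTail

lemma integral_avgGaussTail_inv_mul {σ : ℝ} (hσ : 0 < σ) :
    ∫ x in Ioi 0, avgGaussTail (σ⁻¹ * x) = σ * ∫ x in Ioi 0, avgGaussTail x := by
  simpa using integral_comp_mul_left_Ioi avgGaussTail 0 (inv_pos.2 hσ)

/-- `f` is Lebesgue integrable on `ℝ` and
`(1/σ₊²) ∫_0^∞ f(x) dx + (1/σ₋²) ∫_{−∞}^0 f(x) dx = 0`. -/
theorem signChangeFun_integrable_and_cancel (σp σm : ℝ) (hσp : 0 < σp) (hσm : 0 < σm) :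
    Integrable (signChangeFun σp σm) volume ∧
    (1 / σp ^ 2) * (∫ x in Set.Ioi (0 : ℝ), signChangeFun σp σm x)
      + (1 / σm ^ 2) * (∫ x in Set.Iio (0 : ℝ), signChangeFun σp σm x) = 0 := by
  have hpos : EqOn (signChangeFun σp σm)
      (fun x => 2 * σp / (σm + σp) * avgGaussTail (σp⁻¹ * x)) (Ioi 0) :=
    fun x hx => signChangeFun_of_pos σp σm hx
  have hneg : EqOn (fun x => signChangeFun σp σm (-x))
      (fun x => -(2 * σm / (σm + σp) * avgGaussTail (σm⁻¹ * x))) (Ioi 0) :=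
    fun x hx => signChangeFun_neg_of_pos σp σm hx
  constructor
  · rw [← integrableOn_univ, ← Iic_union_Ioi (a := (0 : ℝ)), integrableOn_union,
      integrableOn_Iic_iff_integrableOn_Iio]
    constructor
    · have h : IntegrableOn (fun x => signChangeFun σp σm (-x)) (Ioi (-0)) := by
        rw [neg_zero, integrableOn_congr_fun hneg measurableSet_Ioi]
        exact ((integrableOn_avgGaussTail_inv_mul hσm).const_mul _).neg
      simpa using h.comp_neg_Iio
    · rw [integrableOn_congr_fun hpos measurableSet_Ioi]
      exact (integrableOn_avgGaussTail_inv_mul hσp).const_mul _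
  · have h := integral_comp_neg_Ioi 0 (signChangeFun σp σm)
    rw [neg_zero, integral_Iic_eq_integral_Iio] at h
    rw [← h, setIntegral_congr_fun measurableSet_Ioi hpos,
      setIntegral_congr_fun measurableSet_Ioi hneg, integral_neg, integral_const_mul,
      integral_const_mul, integral_avgGaussTail_inv_mul hσp, integral_avgGaussTail_inv_mul hσm]
    field_simp
    ring
end

section
/- For every r > 0, the function u ↦ (1/π) · (1/√(u(1−u))) · r / (1 − (1−r²) u) is a probability density on (0,1); that is, ∫_0^1 (1/(π √(u(1−u)))) · r/(1 − (1−r²)u) du = 1. -/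
open MeasureTheory Real Set

/-- The denominator of the modified arcsine density is positive on `[0, 1]`. -/
lemma modified_arcsine_denom_pos {r u : ℝ} (hr : 0 < r) (hu : u ∈ Icc (0 : ℝ) 1) :
    0 < 1 - (1 - r ^ 2) * u := by
  obtain ⟨h0, h1⟩ := hu
  have hr2 : 0 < r ^ 2 := by positivity
  rcases h0.eq_or_lt with rfl | h0
  · simp
  · nlinarith [mul_pos hr2 h0]

/-- The distribution function of the modified arcsine law, in closed form, is an antiderivative
of its density. -/
lemma hasDerivAt_modified_arcsine_cdf {r u : ℝ} (hr : 0 < r) (hu : u ∈ Ioo (0 : ℝ) 1) :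
    HasDerivAt
      (fun x : ℝ ↦ 1 / π * arccos ((1 - (1 + r ^ 2) * x) / (1 - (1 - r ^ 2) * x)))
      (1 / π * (1 / √(u * (1 - u))) * (r / (1 - (1 - r ^ 2) * u))) u := by
  have hD := modified_arcsine_denom_pos hr (Ioo_subset_Icc_self hu)
  have hw : 0 < u * (1 - u) := mul_pos hu.1 (sub_pos.2 hu.2)
  have hs : 0 < √(u * (1 - u)) := sqrt_pos.2 hw
  have hlin (c : ℝ) : HasDerivAt (fun x : ℝ ↦ 1 - c * x) (-c) u := by
    simpa using ((hasDerivAt_id u).const_mul c).const_sub 1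
  have hg := (hlin (1 + r ^ 2)).div (hlin (1 - r ^ 2)) hD.ne'
  have hsq : 1 - ((1 - (1 + r ^ 2) * u) / (1 - (1 - r ^ 2) * u)) ^ 2
      = (2 * r * √(u * (1 - u)) / (1 - (1 - r ^ 2) * u)) ^ 2 := by
    have hD2 := (pow_pos hD 2).ne'
    rw [div_pow, div_pow, mul_pow, sq_sqrt hw.le, eq_div_iff hD2, sub_mul, div_mul_cancel₀ _ hD2]
    ring
  have hsqrt := congrArg sqrt hsq
  rw [sqrt_sq (by positivity)] at hsqrt
  have hlt : 0 < 1 - ((1 - (1 + r ^ 2) * u) / (1 - (1 - r ^ 2) * u)) ^ 2 := by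
    rw [hsq]; positivity
  have hne1 : (1 - (1 + r ^ 2) * u) / (1 - (1 - r ^ 2) * u) ≠ -1 := fun h ↦ by
    rw [h] at hlt; norm_num at hlt
  have hne2 : (1 - (1 + r ^ 2) * u) / (1 - (1 - r ^ 2) * u) ≠ 1 := fun h ↦ by
    rw [h] at hlt; norm_num at hlt
  refine (((hasDerivAt_arccos hne1 hne2).comp u hg).const_mul (1 / π)).congr_deriv ?_
  rw [hsqrt]
  field_simp
  ring

/-- the modified arcsine law
`u ↦ (1/π) (1/√(u(1−u))) r/(1 − (1−r²)u)` is a probability density on `(0,1)`. -/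
theorem modified_arcsine_density (r : ℝ) (hr : 0 < r) :
    ∫ u in Set.Ioo (0 : ℝ) 1,
        (1 / Real.pi) * (1 / Real.sqrt (u * (1 - u))) * (r / (1 - (1 - r ^ 2) * u)) = 1 := by
  have hcont : ContinuousOn
      (fun x : ℝ ↦ 1 / π * arccos ((1 - (1 + r ^ 2) * x) / (1 - (1 - r ^ 2) * x)))
      (Icc 0 1) :=
    continuousOn_const.mul <| continuous_arccos.comp_continuousOn <|
      ContinuousOn.div (by fun_prop) (by fun_prop)
        fun x hx ↦ (modified_arcsine_denom_pos hr hx).ne'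
  have hderiv := fun x hx ↦ hasDerivAt_modified_arcsine_cdf (u := x) hr hx
  have hint := intervalIntegral.integrableOn_deriv_of_nonneg hcont hderiv fun x hx ↦ by
    have := modified_arcsine_denom_pos hr (Ioo_subset_Icc_self hx)
    positivity
  rw [← integral_Ioc_eq_integral_Ioo, ← intervalIntegral.integral_of_le zero_le_one,
    intervalIntegral.integral_eq_sub_of_hasDerivAt_of_le zero_le_one hcont hderiv
      ((intervalIntegrable_iff_integrableOn_Ioc_of_le zero_le_one).2 hint)]
  have h1 : (1 - (1 + r ^ 2) * 1) / (1 - (1 - r ^ 2) * 1) = -1 := by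
    field_simp
    ring
  simp only [h1, arccos_neg_one]
  simp [pi_ne_zero]
end
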